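/- arXiv:1802.03331 — 5 statements merged into one kernel-verified Lean document; each statement's English description precedes it below -/
import Mathlib

section
/- Let n ≥ 2 be an integer and τ ≤ 0 a real constant. Let f : [b₁,a₂] → ℝ be a C² positive function which is concave, i.e. f'' ≤ 0 on [b₁,a₂], and suppose 0 < f'(b₁) < √(1 − τ f(b₁)²/(n(n−1))) and f'(a₂) > −√(1 − τ f(a₂)²/(n(n−1))). Then 1 − f'(s)² − τ f(s)²/(n(n−1)) > 0 for every s ∈ [b₁,a₂]; equivalently, Ω[f](s) := ((n−1)/(2 f(s)))·(1 − f'(s)² − τ f(s)²/(n(n−1))) > 0 on [b₁,a₂]. -/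
open Set

/-- If `f` is positive with antitone derivative on `[b, a]` and `c ≥ 0`, then the bound
`f' ^ 2 < 1 + c * f ^ 2` propagates from the endpoints, where it is only required one-sidedly,
to the whole interval. -/
theorem deriv_sq_lt_one_add_mul_sq {f : ℝ → ℝ} {a b c : ℝ} (hc : 0 ≤ c)
    (hf : Differentiable ℝ f) (hpos : ∀ s ∈ Icc b a, 0 < f s)
    (hanti : AntitoneOn (deriv f) (Icc b a))
    (hb : deriv f b < √(1 + c * f b ^ 2)) (ha : -√(1 + c * f a ^ 2) < deriv f a)
    {s : ℝ} (hs : s ∈ Icc b a) : deriv f s ^ 2 < 1 + c * f s ^ 2 := by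
  have hba : b ≤ a := hs.1.trans hs.2
  have hbmem : b ∈ Icc b a := left_mem_Icc.2 hba
  have hamem : a ∈ Icc b a := right_mem_Icc.2 hba
  rcases le_or_gt 0 (deriv f s) with h | h
  · have hmono : MonotoneOn f (Icc b s) :=
      monotoneOn_of_deriv_nonneg (convex_Icc b s) hf.continuous.continuousOn
        hf.differentiableOn fun t ht => by
          rw [interior_Icc] at ht
          exact h.trans (hanti ⟨ht.1.le, ht.2.le.trans hs.2⟩ hs ht.2.le)
    have hfle : f b ≤ f s := hmono (left_mem_Icc.2 hs.1) (right_mem_Icc.2 hs.1) hs.1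
    have hfb := (hpos b hbmem).le
    calc deriv f s ^ 2 < 1 + c * f b ^ 2 :=
          (Real.lt_sqrt h).1 ((hanti hbmem hs hs.1).trans_lt hb)
      _ ≤ 1 + c * f s ^ 2 := by gcongr
  · have hmono : AntitoneOn f (Icc s a) :=
      antitoneOn_of_deriv_nonpos (convex_Icc s a) hf.continuous.continuousOn
        hf.differentiableOn fun t ht => by
          rw [interior_Icc] at ht
          exact (hanti hs ⟨hs.1.trans ht.1.le, ht.2.le⟩ ht.1.le).trans h.le
    have hfle : f a ≤ f s := hmono (left_mem_Icc.2 hs.2) (right_mem_Icc.2 hs.2) hs.2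
    have hfa := (hpos a hamem).le
    have hlt : -deriv f s < √(1 + c * f a ^ 2) :=
      neg_lt.1 (ha.trans_le (hanti hs hamem hs.2))
    calc deriv f s ^ 2 = (-deriv f s) ^ 2 := (neg_sq _).symm
      _ < 1 + c * f a ^ 2 := (Real.lt_sqrt (neg_nonneg.2 h.le)).1 hlt
      _ ≤ 1 + c * f s ^ 2 := by gcongr

theorem bridge_positivity
    (n : ℕ) (hn : 2 ≤ n) (τ : ℝ) (hτ : τ ≤ 0)
    (b₁ a₂ : ℝ) (hle : b₁ ≤ a₂)
    (f : ℝ → ℝ) (hf : ContDiff ℝ 2 f)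
    (hfpos : ∀ s ∈ Icc b₁ a₂, 0 < f s)
    (hconc : ∀ s ∈ Icc b₁ a₂, deriv (deriv f) s ≤ 0)
    (h₁ : 0 < deriv f b₁)
    (h₂ : deriv f b₁ < Real.sqrt (1 - τ * (f b₁) ^ 2 / ((n : ℝ) * ((n : ℝ) - 1))))
    (h₃ : -Real.sqrt (1 - τ * (f a₂) ^ 2 / ((n : ℝ) * ((n : ℝ) - 1))) < deriv f a₂) :
    ∀ s ∈ Icc b₁ a₂,
      0 < 1 - (deriv f s) ^ 2 - τ * (f s) ^ 2 / ((n : ℝ) * ((n : ℝ) - 1)) := by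
  have hn' : (2 : ℝ) ≤ n := by exact_mod_cast hn
  have hc : 0 ≤ -τ / ((n : ℝ) * ((n : ℝ) - 1)) :=
    div_nonneg (neg_nonneg.2 hτ) (mul_nonneg (by linarith) (by linarith))
  have hrw : ∀ x : ℝ, 1 - τ * x ^ 2 / ((n : ℝ) * ((n : ℝ) - 1)) =
      1 + -τ / ((n : ℝ) * ((n : ℝ) - 1)) * x ^ 2 := fun x => by ring
  rw [hrw] at h₂ h₃
  have hf' : ContDiff ℝ 1 (deriv f) := hf.deriv' (n := 1)
  have hanti : AntitoneOn (deriv f) (Icc b₁ a₂) :=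
    antitoneOn_of_deriv_nonpos (convex_Icc b₁ a₂) hf'.continuous.continuousOn
      (hf'.differentiable one_ne_zero).differentiableOn
      fun t ht => hconc t (interior_subset ht)
  intro s hs
  have hlt := deriv_sq_lt_one_add_mul_sq hc (hf.differentiable two_ne_zero) hfpos hanti h₂ h₃ hs
  rw [← hrw] at hlt
  linarith
end

section
/- Let r, A, u₁ be positive real numbers. Then there exists a constant C > 0, depending only on r, A and u₁, such that for every ε ∈ (0,1) with ε/(1+ε) < A² u₁², one has ((1+ε)^{1/2} r / 2)·(1 − r² ε² / (A² u₁² (1+ε)) + r² (1+ε)) ≤ (r/2)·(1 + r²) + √ε · C. -/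
theorem hawking_mass_estimate_minimal_collar
    (r A u₁ : ℝ) (hr : 0 < r) (hA : 0 < A) (hu₁ : 0 < u₁) :
    ∃ C : ℝ, 0 < C ∧ ∀ ε : ℝ, 0 < ε → ε < 1 → ε / (1 + ε) < A ^ 2 * u₁ ^ 2 →
      Real.sqrt (1 + ε) * r / 2 *
          (1 - r ^ 2 * ε ^ 2 / (A ^ 2 * u₁ ^ 2 * (1 + ε)) + r ^ 2 * (1 + ε))
        ≤ r / 2 * (1 + r ^ 2) + Real.sqrt ε * C := by
  refine ⟨r / 2 * (1 + 3 * r ^ 2), by positivity, fun ε hε hε1 _ => ?_⟩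
  have hdrop : 0 ≤ r ^ 2 * ε ^ 2 / (A ^ 2 * u₁ ^ 2 * (1 + ε)) := by positivity
  have hsqrt : Real.sqrt (1 + ε) ≤ 1 + ε := Real.sqrt_le_iff.2 ⟨by linarith, by nlinarith⟩
  have hε_le : ε ≤ Real.sqrt ε := Real.le_sqrt_of_sq_le (by nlinarith)
  calc Real.sqrt (1 + ε) * r / 2 *
          (1 - r ^ 2 * ε ^ 2 / (A ^ 2 * u₁ ^ 2 * (1 + ε)) + r ^ 2 * (1 + ε))
      ≤ Real.sqrt (1 + ε) * r / 2 * (1 + r ^ 2 * (1 + ε)) := by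
        gcongr
        linarith
    _ ≤ (1 + ε) * r / 2 * (1 + r ^ 2 * (1 + ε)) := by gcongr
    _ = r / 2 * (1 + r ^ 2) + ε * (r / 2 * (1 + (2 + ε) * r ^ 2)) := by ring
    _ ≤ r / 2 * (1 + r ^ 2) + Real.sqrt ε * (r / 2 * (1 + 3 * r ^ 2)) := by
        gcongr
        linarith
end

section
/- Let m < 0 and r, H, A > 0 with H² r² / 4 < 1 + 3r². Set k := (H r / 2)·(1 − 2m/r)^{−1/2}, and let u : [0,∞) → ℝ be a differentiable function with u(s) > 0 for all s, u(0) = r, u increasing, and u'(s) = √(1 − 2m/u(s)) for all s ≥ 0. Then (u(Ak)/2)·(1 − k² + u(Ak)²) + k² m ≤ (HA/2 + 1)·(r/2)·(1 − H²r²/4 + r²) − (HA/2)·k² m + (r³/2)·(HA/2 + 1)·((HA/2 + 1)² − 1). -/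
open Set

theorem schwarzschild_collar_hawking_mass_bound
    (m r H A : ℝ) (hm : m < 0) (hr : 0 < r) (hH : 0 < H) (hA : 0 < A)
    (hHr : H ^ 2 * r ^ 2 / 4 < 1 + 3 * r ^ 2)
    (k : ℝ) (hk : k = H * r / 2 * (Real.sqrt (1 - 2 * m / r))⁻¹)
    (u : ℝ → ℝ)
    (hupos : ∀ s ∈ Ici (0 : ℝ), 0 < u s)
    (hu0 : u 0 = r)
    (hmono : MonotoneOn u (Ici (0 : ℝ)))
    (hderiv : ∀ s ∈ Ici (0 : ℝ),
      HasDerivWithinAt u (Real.sqrt (1 - 2 * m / u s)) (Ici 0) s) :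
    u (A * k) / 2 * (1 - k ^ 2 + u (A * k) ^ 2) + k ^ 2 * m
      ≤ (H * A / 2 + 1) * (r / 2) * (1 - H ^ 2 * r ^ 2 / 4 + r ^ 2)
        - H * A / 2 * (k ^ 2 * m)
        + r ^ 3 / 2 * (H * A / 2 + 1) * ((H * A / 2 + 1) ^ 2 - 1) := by
  have hq : 0 < 1 - 2 * m / r := by
    have : 2 * m / r < 0 := div_neg_of_neg_of_pos (by linarith) hr
    linarith
  have hsq := Real.sq_sqrt hq.le
  have hspos := Real.sqrt_pos.2 hq
  set S := Real.sqrt (1 - 2 * m / r) with hS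
  have hkS : k * S = H * r / 2 := by
    rw [hk]; field_simp
  have hkpos : 0 < k := by rw [hk]; positivity
  have hAk : 0 ≤ A * k := by positivity
  have hur : ∀ s ∈ Ici (0 : ℝ), r ≤ u s := fun s hs =>
    hu0 ▸ hmono (mem_Ici.2 le_rfl) hs hs
  have hbound : ∀ s ∈ Ici (0 : ℝ), ‖Real.sqrt (1 - 2 * m / u s)‖ ≤ S := by
    intro s hs
    rw [Real.norm_of_nonneg (Real.sqrt_nonneg _)]
    apply Real.sqrt_le_sqrt
    have h1 : (-2 * m) / u s ≤ (-2 * m) / r :=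
      div_le_div_of_nonneg_left (by linarith) hr (hur s hs)
    simp only [neg_mul, neg_div] at h1
    linarith
  have hU := (convex_Ici (0 : ℝ)).norm_image_sub_le_of_norm_hasDerivWithin_le hderiv hbound
    (mem_Ici.2 le_rfl) (mem_Ici.2 hAk)
  rw [hu0, sub_zero, Real.norm_of_nonneg hAk] at hU
  have hUle : u (A * k) ≤ (H * A / 2 + 1) * r := by
    have h1 := (le_abs_self _).trans hU
    have h2 : S * (A * k) = A * (H * r / 2) := by rw [← hkS]; ring
    linarith
  have hUr := hur (A * k) hAk
  have hk2 : k ^ 2 * r - 2 * m * k ^ 2 = H ^ 2 * r ^ 2 / 4 * r := by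
    have h1 : H ^ 2 * r ^ 2 / 4 = k ^ 2 * (1 - 2 * m / r) := by
      rw [← hsq, ← mul_pow k S, hkS]; ring
    rw [h1]; field_simp
  have hkle : k ^ 2 < 1 + 3 * r ^ 2 := by
    have h1 : k ^ 2 * r ≤ H ^ 2 * r ^ 2 / 4 * r := by nlinarith [sq_nonneg k]
    exact (le_of_mul_le_mul_right h1 hr).trans_lt hHr
  generalize u (A * k) = x at hUle hUr ⊢
  set y := (H * A / 2 + 1) * r with hy
  have hprod : 0 ≤ (y - x) * (1 - k ^ 2 + x ^ 2 + x * y + y ^ 2) := by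
    have hry : r ≤ y := hUr.trans hUle
    apply mul_nonneg (sub_nonneg.2 hUle)
    nlinarith [mul_le_mul hUr hry hr.le (hr.le.trans hUr)]
  have hrhs : (H * A / 2 + 1) * (r / 2) * (1 - H ^ 2 * r ^ 2 / 4 + r ^ 2)
        - H * A / 2 * (k ^ 2 * m)
        + r ^ 3 / 2 * (H * A / 2 + 1) * ((H * A / 2 + 1) ^ 2 - 1)
      = y / 2 * (1 - k ^ 2 + y ^ 2) + k ^ 2 * m := by
    rw [hy]
    linear_combination ((H * A / 2 + 1) / 2) * hk2
  rw [hrhs]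
  linarith
end

section
/- Let m < 0, b > 0, r > 0, and let u : [0,∞) → ℝ be a differentiable function with u(s) > 0 for all s, u(0) = r, and u'(s) = √(1 + b u(s)² − 2m/u(s)) for all s ≥ 0. Then for all s ≥ 0: u(s) ≤ b^{−1/2}·sinh(√b·√(1 − 2m/(r(1 + b r²)))·s + arsinh(√b·r)). -/
open Set

theorem sqrt_profile_le (m b r v : ℝ) (hm : m ≤ 0) (hb : 0 ≤ b) (hr : 0 < r) (hv : r ≤ v) :
    Real.sqrt (1 + b * v ^ 2 - 2 * m / v) ≤
      Real.sqrt (1 - 2 * m / (r * (1 + b * r ^ 2))) * Real.sqrt (1 + b * v ^ 2) := by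
  have hv0 : 0 < v := hr.trans_le hv
  have hW : 0 < 1 + b * v ^ 2 := by positivity
  rw [← Real.sqrt_mul' _ hW.le]
  apply Real.sqrt_le_sqrt
  have key : -(2 * m) / (v * (1 + b * v ^ 2)) ≤ -(2 * m) / (r * (1 + b * r ^ 2)) := by
    apply div_le_div_of_nonneg_left (by linarith) (by positivity)
    gcongr
  calc 1 + b * v ^ 2 - 2 * m / v
      = (1 + -(2 * m) / (v * (1 + b * v ^ 2))) * (1 + b * v ^ 2) := by field_simp; ring
    _ ≤ (1 + -(2 * m) / (r * (1 + b * r ^ 2))) * (1 + b * v ^ 2) := by gcongr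
    _ = _ := by rw [neg_div]; ring

theorem adsSchwarzschild_profile_sinh_bound
    (m b r : ℝ) (hm : m < 0) (hb : 0 < b) (hr : 0 < r)
    (u : ℝ → ℝ)
    (hupos : ∀ s ∈ Ici (0 : ℝ), 0 < u s)
    (hu0 : u 0 = r)
    (hderiv : ∀ s ∈ Ici (0 : ℝ),
      HasDerivWithinAt u (Real.sqrt (1 + b * (u s) ^ 2 - 2 * m / u s)) (Ici 0) s) :
    ∀ s ∈ Ici (0 : ℝ),
      u s ≤ (Real.sqrt b)⁻¹ *
        Real.sinh (Real.sqrt b * Real.sqrt (1 - 2 * m / (r * (1 + b * r ^ 2))) * s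
          + Real.arsinh (Real.sqrt b * r)) := by
  set c := Real.sqrt (1 - 2 * m / (r * (1 + b * r ^ 2)))
  have hsb : 0 < Real.sqrt b := Real.sqrt_pos.2 hb
  have hmono : MonotoneOn u (Ici 0) :=
    monotoneOn_of_hasDerivWithinAt_nonneg (convex_Ici 0)
      (fun s hs => (hderiv s hs).continuousWithinAt)
      (fun s hs => (hderiv s (interior_subset hs)).mono interior_subset)
      (fun s _ => Real.sqrt_nonneg _)
  have hge : ∀ s ∈ Ici (0 : ℝ), r ≤ u s := fun s hs => hu0 ▸ hmono self_mem_Ici hs hs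
  have hd : ∀ s ∈ Ici (0 : ℝ), HasDerivWithinAt
      (fun s => Real.sqrt b * c * s - Real.arsinh (Real.sqrt b * u s))
      (Real.sqrt b * c - (Real.sqrt (1 + (Real.sqrt b * u s) ^ 2))⁻¹ *
        (Real.sqrt b * Real.sqrt (1 + b * (u s) ^ 2 - 2 * m / u s))) (Ici 0) s := by
    intro s hs
    have h := ((hderiv s hs).const_mul (Real.sqrt b)).arsinh
    have hlin : HasDerivWithinAt (fun s => Real.sqrt b * c * s) (Real.sqrt b * c) (Ici 0) s := by
      simpa using (hasDerivWithinAt_id s (Ici 0)).const_mul (Real.sqrt b * c)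
    exact hlin.sub h
  have hgap : MonotoneOn (fun s => Real.sqrt b * c * s - Real.arsinh (Real.sqrt b * u s))
      (Ici 0) := by
    refine monotoneOn_of_hasDerivWithinAt_nonneg (convex_Ici 0)
      (fun s hs => (hd s hs).continuousWithinAt)
      (fun s hs => (hd s (interior_subset hs)).mono interior_subset) (fun s hs => ?_)
    have h := sqrt_profile_le m b r (u s) hm.le hb.le hr (hge s (interior_subset hs))
    have hW : 0 < Real.sqrt (1 + b * u s ^ 2) := Real.sqrt_pos.2 (by positivity)
    rw [mul_pow, Real.sq_sqrt hb.le, sub_nonneg, inv_mul_le_iff₀ hW]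
    calc _ ≤ Real.sqrt b * (c * Real.sqrt (1 + b * u s ^ 2)) := by gcongr
      _ = _ := by ring
  intro s hs
  have h := hgap self_mem_Ici hs hs
  simp only [hu0, mul_zero] at h
  rw [← div_eq_inv_mul, le_div_iff₀' hsb, ← Real.arsinh_le_arsinh, Real.arsinh_sinh]
  linarith
end

section
/- Let m < 0, b > 0, r > 0, and let u : [0,∞) → ℝ be a differentiable function with u(s) > 0 for all s, u(0) = r, and u'(s) = √(1 + b u(s)² − 2m/u(s)) for all s ≥ 0. Set c := √b·√(1 − 2m/(r(1 + b r²))). Then for all s ≥ 0: u(s) ≤ r·cosh(c s) + √(b^{−1} + r²)·sinh(c s). -/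
open Set

theorem adsSchwarzschild_profile_cosh_sinh_bound
    (m b r : ℝ) (hm : m < 0) (hb : 0 < b) (hr : 0 < r)
    (u : ℝ → ℝ)
    (hupos : ∀ s ∈ Ici (0 : ℝ), 0 < u s)
    (hu0 : u 0 = r)
    (hderiv : ∀ s ∈ Ici (0 : ℝ),
      HasDerivWithinAt u (Real.sqrt (1 + b * (u s) ^ 2 - 2 * m / u s)) (Ici 0) s)
    (c : ℝ) (hc : c = Real.sqrt b * Real.sqrt (1 - 2 * m / (r * (1 + b * r ^ 2)))) :
    ∀ s ∈ Ici (0 : ℝ),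
      u s ≤ r * Real.cosh (c * s) + Real.sqrt (b⁻¹ + r ^ 2) * Real.sinh (c * s) := by
  have hmono : MonotoneOn u (Ici 0) :=
    monotoneOn_of_hasDerivWithinAt_nonneg (convex_Ici 0)
      (fun s hs => (hderiv s hs).continuousWithinAt)
      (fun s hs => (hderiv s (interior_subset hs)).mono interior_subset)
      (fun s _ => Real.sqrt_nonneg _)
  have hur : ∀ s ∈ Ici (0 : ℝ), r ≤ u s := fun s hs =>
    hu0 ▸ hmono self_mem_Ici hs hs
  have hspeed : ∀ s ∈ Ici (0 : ℝ),
      √(1 + b * (u s) ^ 2 - 2 * m / u s) ≤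
        √(1 + b * (u s) ^ 2) * √(1 - 2 * m / (r * (1 + b * r ^ 2))) := by
    intro s hs
    have hu := hupos s hs
    have hru := hur s hs
    have hw : 0 < 1 + b * (u s) ^ 2 := by positivity
    rw [← Real.sqrt_mul hw.le]
    apply Real.sqrt_le_sqrt
    have hfactor : 1 + b * (u s) ^ 2 - 2 * m / u s =
        (1 + b * (u s) ^ 2) * (1 + (-2 * m) / (u s * (1 + b * (u s) ^ 2))) := by
      field_simp
      ring
    have hcoeff : 1 - 2 * m / (r * (1 + b * r ^ 2)) =
        1 + (-2 * m) / (r * (1 + b * r ^ 2)) := by ring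
    have hm' : 0 ≤ -2 * m := by linarith
    rw [hfactor, hcoeff]
    gcongr
  have hderiv' : ∀ s ∈ Ici (0 : ℝ),
      HasDerivWithinAt (fun s => Real.arsinh (√b * u s) - c * s)
        ((√(1 + (√b * u s) ^ 2))⁻¹ • (√b * √(1 + b * (u s) ^ 2 - 2 * m / u s)) - c * 1)
        (Ici 0) s := fun s hs =>
    (((hderiv s hs).const_mul (√b)).arsinh).sub ((hasDerivWithinAt_id s _).const_mul c)
  have hanti : AntitoneOn (fun s => Real.arsinh (√b * u s) - c * s) (Ici 0) := by
    refine antitoneOn_of_hasDerivWithinAt_nonpos (convex_Ici 0)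
      (fun s hs => (hderiv' s hs).continuousWithinAt)
      (fun s hs => (hderiv' s (interior_subset hs)).mono interior_subset) ?_
    intro s hs
    have hw : 0 < √(1 + b * (u s) ^ 2) := by positivity
    rw [mul_pow, Real.sq_sqrt hb.le, smul_eq_mul, mul_one, sub_nonpos, inv_mul_le_iff₀ hw, hc]
    calc √b * √(1 + b * (u s) ^ 2 - 2 * m / u s)
        ≤ √b * (√(1 + b * (u s) ^ 2) * √(1 - 2 * m / (r * (1 + b * r ^ 2)))) := by
          gcongr
          exact hspeed s (interior_subset hs)
      _ = _ := by ring
  intro s hs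
  have harsinh : Real.arsinh (√b * u s) ≤ c * s + Real.arsinh (√b * r) := by
    have h := hanti self_mem_Ici hs hs
    simp only [hu0, mul_zero, sub_zero] at h
    linarith
  have hsinh := Real.sinh_le_sinh.2 harsinh
  have hsqrt : √(1 + (√b * r) ^ 2) = √b * √(b⁻¹ + r ^ 2) := by
    rw [← Real.sqrt_mul hb.le, mul_pow, Real.sq_sqrt hb.le, mul_add, mul_inv_cancel₀ hb.ne']
  rw [Real.sinh_add, Real.sinh_arsinh, Real.sinh_arsinh, Real.cosh_arsinh, hsqrt] at hsinh
  refine le_of_mul_le_mul_left ?_ (Real.sqrt_pos.2 hb)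
  linarith
end
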